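/- Let n ≥ 1 and let K be a field of characteristic zero. For the cochain complex (C^•, d) of ordered partitions of {1,…,n} (the multidegree-(1,…,1) part of the cobar construction of the polynomial coalgebra K[t_1,…,t_n]), the cohomology vanishes below the top degree: for every k with 1 ≤ k ≤ n−1, ker(d : C^k → C^{k+1}) = im(d : C^{k−1} → C^k). -/

import Mathlib

/-!
The cochain complex of ordered partitions of `{1,…,n}` (the multidegree-`(1,…,1)` part of
the cobar construction of the polynomial coalgebra `K[t₁,…,tₙ]`).

An ordered partition of `{1,…,n}` (modeled on `Fin n`) into `k` blocks is a tuple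
`(B₁,…,B_k)` of pairwise disjoint nonempty subsets covering `{1,…,n}`; equivalently,
every block is nonempty and every element lies in exactly one block.
-/

/-- `B : Fin k → Finset (Fin n)` is an ordered partition: all blocks are nonempty and
every element of `{1,…,n}` lies in exactly one block (this encodes pairwise disjointness
together with the covering property). -/
def IsOrderedPartition (n k : ℕ) (B : Fin k → Finset (Fin n)) : Prop :=
  (∀ i, (B i).Nonempty) ∧ ∀ x : Fin n, ∃! i, x ∈ B i

/-- The set of ordered partitions of `{1,…,n}` into `k` blocks. -/
def OrderedPartition (n k : ℕ) : Type :=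
  {B : Fin k → Finset (Fin n) // IsOrderedPartition n k B}

/-- `C^k`, the free `K`-vector space on the set of ordered partitions of `{1,…,n}`
into `k` blocks. -/
abbrev OPC (K : Type*) [Field K] (n k : ℕ) : Type _ :=
  OrderedPartition n k →₀ K

/-- Replace the `i`-th block of the tuple `B` by the two consecutive blocks `A`, `A'`
(at positions `i` and `i+1`), shifting the later blocks by one. -/
def splitBlocks {n k : ℕ} (B : Fin k → Finset (Fin n)) (i : Fin k)
    (A A' : Finset (Fin n)) : Fin (k + 1) → Finset (Fin n) :=
  Function.update (i.succ.insertNth A' B) i.castSucc A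

open Classical in
/-- The differential `d : C^k → C^{k+1}`.  On a basis ordered partition `(B₁,…,B_k)` it is
`d(B₁,…,B_k) = Σ_{i} (−1)^{i} Σ_{(A,A')} (B₁,…,B_{i−1}, A, A', B_{i+1},…,B_k)`, the inner
sum running over all ordered pairs `(A, A')` of disjoint nonempty subsets with
`A ∪ A' = B_i` (such a pair is the same as a subset `A ⊆ B_i` with `A' = B_i \ A`;
the resulting tuple is an ordered partition exactly when both `A` and `A'` are nonempty,
which is what the `dite` below selects).  Here `i` runs over `Fin k` (zero-based), so the
sign `(−1)^i` matches the one-based sign `(−1)^{i−1}` of the informal statement. -/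
noncomputable def dOP (K : Type*) [Field K] (n k : ℕ) :
    OPC K n k →ₗ[K] OPC K n (k + 1) :=
  Finsupp.lsum K fun B => LinearMap.toSpanSingleton K _ <|
    ∑ i : Fin k, ∑ A ∈ (B.1 i).powerset,
      if h : IsOrderedPartition n (k + 1) (splitBlocks B.1 i A (B.1 i \ A)) then
        ((-1 : K) ^ (i : ℕ)) • Finsupp.single (⟨_, h⟩ : OrderedPartition n (k + 1)) (1 : K)
      else 0

namespace OrderedPartitionComplex

open Finset

section Words

variable (K : Type*) [Field K] {α : Type*} [DecidableEq α]

/-- Prepending the block `B` to a word of blocks, extended linearly; the empty block acts as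
zero. -/
noncomputable def prepend (B : Finset α) :
    (List (Finset α) →₀ K) →ₗ[K] (List (Finset α) →₀ K) :=
  if B = ∅ then 0 else Finsupp.lmapDomain K K (List.cons B)

/-- The cobar differential of a word of blocks. -/
noncomputable def differentialWord : List (Finset α) → (List (Finset α) →₀ K)
  | [] => 0
  | B :: w => ∑ A ∈ B.powerset, prepend K A (prepend K (B \ A) (Finsupp.single w 1)) -
      prepend K B (differentialWord w)

/-- The cobar differential on the span of all words of blocks. -/
noncomputable def differential : (List (Finset α) →₀ K) →ₗ[K] (List (Finset α) →₀ K) :=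
  Finsupp.linearCombination K (differentialWord K)

/-- Adding the letter `m` to the first block of a word. -/
noncomputable def absorb (m : α) : (List (Finset α) →₀ K) →ₗ[K] (List (Finset α) →₀ K) :=
  Finsupp.linearCombination K fun
    | [] => 0
    | C :: w => if C = ∅ then 0 else Finsupp.single (insert m C :: w) 1

/-- Merging the block `{m}` of a word with the block that follows it; words in which `m` lies in
a larger block, or in which `{m}` comes last, are sent to zero. -/
noncomputable def homotopyWord (m : α) : List (Finset α) → (List (Finset α) →₀ K)
  | [] => 0
  | B :: w =>
      if B = {m} then absorb K m (Finsupp.single w 1)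
      else if m ∈ B then 0
      else -prepend K B (homotopyWord m w)

/-- The linear extension of `homotopyWord`. -/
noncomputable def homotopy (m : α) : (List (Finset α) →₀ K) →ₗ[K] (List (Finset α) →₀ K) :=
  Finsupp.linearCombination K (homotopyWord K m)

/-- The endomorphism `1 - (d h + h d)`, which moves the letter `m` to the right. -/
noncomputable def shift (m : α) : (List (Finset α) →₀ K) →ₗ[K] (List (Finset α) →₀ K) :=
  LinearMap.id - (differential K ∘ₗ homotopy K m + homotopy K m ∘ₗ differential K)

/-- Appending the block `{m}` at the end of words. -/
noncomputable def appendSingleton (m : α) :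
    (List (Finset α) →₀ K) →ₗ[K] (List (Finset α) →₀ K) :=
  Finsupp.lmapDomain K K (· ++ [{m}])

variable {K}

@[simp]
lemma prepend_empty : prepend K (∅ : Finset α) = 0 := by simp [prepend]

lemma prepend_single {B : Finset α} (hB : B.Nonempty) (w : List (Finset α)) (c : K) :
    prepend K B (Finsupp.single w c) = Finsupp.single (B :: w) c := by
  simp [prepend, hB.ne_empty]

@[simp]
lemma differential_single_nil (c : K) :
    differential K (Finsupp.single ([] : List (Finset α)) c) = 0 := by
  simp [differential, differentialWord]

lemma differential_prepend (B : Finset α) (x : List (Finset α) →₀ K) :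
    differential K (prepend K B x) =
      ∑ A ∈ B.powerset, prepend K A (prepend K (B \ A) x) - prepend K B (differential K x) := by
  rcases B.eq_empty_or_nonempty with rfl | hB
  · simp
  induction x using Finsupp.induction_linear with
  | zero => simp
  | add x y hx hy => simp only [map_add, hx, hy, sum_add_distrib]; abel
  | single w c =>
    rw [prepend_single hB, ← mul_one c, ← smul_eq_mul, ← Finsupp.smul_single,
      ← Finsupp.smul_single]
    simp only [map_smul, ← smul_sum, ← smul_sub]
    simp [differential, differentialWord]

lemma sum_powerset_powerset_sdiff {M : Type*} [AddCommMonoid M] (B : Finset α)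
    (f : Finset α → Finset α → Finset α → M) :
    ∑ A ∈ B.powerset, ∑ A' ∈ A.powerset, f A' (A \ A') (B \ A) =
      ∑ A ∈ B.powerset, ∑ A' ∈ (B \ A).powerset, f A A' ((B \ A) \ A') := by
  rw [sum_sigma', sum_sigma']
  refine sum_nbij' (fun p => ⟨p.2, p.1 \ p.2⟩) (fun p => ⟨p.1 ∪ p.2, p.1⟩) ?_ ?_ ?_ ?_ ?_
  · rintro ⟨A, A'⟩ h
    simp only [mem_sigma, mem_powerset] at h ⊢
    exact ⟨h.2.trans h.1, sdiff_subset_sdiff h.1 le_rfl⟩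
  · rintro ⟨A, A'⟩ h
    simp only [mem_sigma, mem_powerset] at h ⊢
    exact ⟨union_subset h.1 (h.2.trans sdiff_subset), subset_union_left⟩
  · rintro ⟨A, A'⟩ h
    simp only [mem_sigma, mem_powerset] at h
    simp [union_sdiff_of_subset h.2]
  · rintro ⟨A, A'⟩ h
    simp only [mem_sigma, mem_powerset] at h
    have : Disjoint A' A := disjoint_of_subset_left h.2 sdiff_disjoint
    simp [union_sdiff_left, sdiff_eq_self_of_disjoint this]
  · rintro ⟨A, A'⟩ h
    simp only [mem_sigma, mem_powerset] at h
    simp [sdiff_sdiff_left, union_eq_right.2 h.2]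

@[simp]
lemma homotopy_single_nil (m : α) (c : K) :
    homotopy K m (Finsupp.single ([] : List (Finset α)) c) = 0 := by
  simp [homotopy, homotopyWord]

@[simp]
lemma absorb_single_nil (m : α) (c : K) :
    absorb K m (Finsupp.single ([] : List (Finset α)) c) = 0 := by
  simp [absorb]

lemma absorb_prepend (m : α) {C : Finset α} (hC : C.Nonempty) (x : List (Finset α) →₀ K) :
    absorb K m (prepend K C x) = prepend K (insert m C) x := by
  induction x using Finsupp.induction_linear with
  | zero => simp
  | add x y hx hy => simp only [map_add, hx, hy]
  | single w c =>
    rw [prepend_single hC, prepend_single (insert_nonempty _ _)]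
    simp [absorb, hC.ne_empty]

lemma homotopy_prepend_of_notMem {m : α} {B : Finset α} (hm : m ∉ B)
    (x : List (Finset α) →₀ K) :
    homotopy K m (prepend K B x) = -prepend K B (homotopy K m x) := by
  rcases B.eq_empty_or_nonempty with rfl | hB
  · simp
  have hB' : B ≠ {m} := by rintro rfl; simp at hm
  induction x using Finsupp.induction_linear with
  | zero => simp
  | add x y hx hy => simp only [map_add, hx, hy, neg_add]
  | single w c =>
    rw [prepend_single hB]
    simp [homotopy, homotopyWord, hm, hB']

lemma homotopy_prepend_singleton (m : α) (x : List (Finset α) →₀ K) :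
    homotopy K m (prepend K {m} x) = absorb K m x := by
  induction x using Finsupp.induction_linear with
  | zero => simp
  | add x y hx hy => simp only [map_add, hx, hy]
  | single w c =>
    rw [prepend_single (singleton_nonempty m), ← mul_one c, ← smul_eq_mul,
      ← Finsupp.smul_single, ← Finsupp.smul_single, map_smul, map_smul]
    simp [homotopy, homotopyWord]

lemma homotopy_prepend_insert {m : α} {C : Finset α} (hC : C.Nonempty) (hm : m ∉ C)
    (x : List (Finset α) →₀ K) :
    homotopy K m (prepend K (insert m C) x) = 0 := by
  have hB' : insert m C ≠ {m} := by
    obtain ⟨a, ha⟩ := hC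
    intro h
    have : a ∈ ({m} : Finset α) := h ▸ mem_insert_of_mem ha
    rw [mem_singleton] at this
    exact hm (this ▸ ha)
  induction x using Finsupp.induction_linear with
  | zero => simp
  | add x y hx hy => simp only [map_add, hx, hy, add_zero]
  | single w c =>
    rw [prepend_single (insert_nonempty _ _)]
    simp [homotopy, homotopyWord, hB']

lemma shift_prepend_of_notMem {m : α} {B : Finset α} (hm : m ∉ B) (x : List (Finset α) →₀ K) :
    shift K m (prepend K B x) = prepend K B (shift K m x) := by
  have key : ∑ A ∈ B.powerset, homotopy K m (prepend K A (prepend K (B \ A) x)) =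
      ∑ A ∈ B.powerset, prepend K A (prepend K (B \ A) (homotopy K m x)) := by
    refine sum_congr rfl fun A hA => ?_
    rw [mem_powerset] at hA
    rw [homotopy_prepend_of_notMem fun h => hm (hA h),
      homotopy_prepend_of_notMem fun h => hm (sdiff_subset h), map_neg, neg_neg]
  simp only [shift, LinearMap.sub_apply, LinearMap.add_apply, LinearMap.comp_apply,
    LinearMap.id_apply, homotopy_prepend_of_notMem hm, differential_prepend, map_sub, map_add,
    map_neg, map_sum, key]
  abel

lemma shift_prepend_insert {m : α} {C : Finset α} (hC : C.Nonempty) (hm : m ∉ C)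
    (x : List (Finset α) →₀ K) :
    shift K m (prepend K (insert m C) x) = prepend K C (absorb K m x) := by
  have h₁ : ∑ A ∈ C.powerset, homotopy K m (prepend K A (prepend K (insert m C \ A) x)) =
      -prepend K C (absorb K m x) := by
    rw [sum_eq_single_of_mem C (mem_powerset_self C)]
    · rw [homotopy_prepend_of_notMem hm, insert_sdiff_of_notMem _ hm, sdiff_self,
        ← homotopy_prepend_singleton]
      rfl
    · intro A hA hne
      rw [mem_powerset] at hA
      have hmA : m ∉ A := fun h => hm (hA h)
      rw [homotopy_prepend_of_notMem hmA, insert_sdiff_of_notMem _ hmA,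
        homotopy_prepend_insert, map_zero, neg_zero]
      · exact sdiff_nonempty.2 fun h => hne (hA.antisymm h)
      · exact fun h => hm (sdiff_subset h)
  have h₂ : ∑ A ∈ C.powerset, homotopy K m
      (prepend K (insert m A) (prepend K (insert m C \ insert m A) x)) =
      prepend K (insert m C) x := by
    rw [sum_eq_single_of_mem ∅ (empty_mem_powerset C)]
    · have : insert m C \ insert m ∅ = C := by simp [insert_sdiff_of_mem, hm]
      rw [this, insert_empty_eq, homotopy_prepend_singleton, absorb_prepend m hC]
    · intro A hA hne
      rw [mem_powerset] at hA
      exact homotopy_prepend_insert (nonempty_iff_ne_empty.2 hne) (fun h => hm (hA h)) _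
  simp only [shift, LinearMap.sub_apply, LinearMap.add_apply, LinearMap.comp_apply,
    LinearMap.id_apply, homotopy_prepend_insert hC hm, differential_prepend, map_sub,
    map_zero, sum_powerset_insert hm, map_add, map_sum, h₁, h₂]
  abel

lemma shift_prepend_singleton (m : α) (x : List (Finset α) →₀ K) :
    shift K m (prepend K {m} x) =
      prepend K {m} x - (differential K (absorb K m x) - absorb K m (differential K x)) := by
  have : ({m} : Finset α) = insert m ∅ := rfl
  simp only [shift, LinearMap.sub_apply, LinearMap.add_apply, LinearMap.comp_apply,
    LinearMap.id_apply, homotopy_prepend_singleton, differential_prepend, map_sub]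
  rw [this, sum_powerset_insert (notMem_empty m)]
  simp [sub_eq_add_neg]

lemma shift_prepend_singleton_prepend {m : α} {C : Finset α} (hC : C.Nonempty) (hm : m ∉ C)
    (x : List (Finset α) →₀ K) :
    shift K m (prepend K {m} (prepend K C x)) =
      -∑ A ∈ C.powerset, prepend K A (prepend K (insert m (C \ A)) x) := by
  have h₁ : ∑ A ∈ C.powerset, prepend K A (prepend K (insert m C \ A) x) =
      ∑ A ∈ C.powerset, prepend K A (prepend K (insert m (C \ A)) x) := by
    refine sum_congr rfl fun A hA => ?_
    rw [mem_powerset] at hA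
    rw [insert_sdiff_of_notMem _ fun h => hm (hA h)]
  have h₂ : ∑ A ∈ C.powerset, prepend K (insert m A) (prepend K (insert m C \ insert m A) x) =
      prepend K {m} (prepend K C x) +
        ∑ A ∈ C.powerset, absorb K m (prepend K A (prepend K (C \ A) x)) := by
    have hs : ∀ A ⊆ C, insert m C \ insert m A = C \ A := fun A hA => by
      ext a
      simp only [mem_sdiff, mem_insert]
      have : a = m → a ∉ C := by rintro rfl; exact hm
      tauto
    rw [← add_sum_erase _ _ (empty_mem_powerset C),
      ← add_sum_erase C.powerset (fun A => absorb K m _) (empty_mem_powerset C),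
      hs ∅ (empty_subset C)]
    simp only [insert_empty_eq, sdiff_empty, prepend_empty, LinearMap.zero_apply, map_zero,
      zero_add]
    congr 1
    refine sum_congr rfl fun A hA => ?_
    rw [mem_erase, mem_powerset] at hA
    rw [absorb_prepend m (nonempty_iff_ne_empty.2 hA.1), hs A hA.2]
  rw [shift_prepend_singleton, absorb_prepend m hC, differential_prepend, differential_prepend,
    map_sub, absorb_prepend m hC, map_sum, sum_powerset_insert hm, h₁, h₂]
  abel

/-- A word of blocks is an ordered partition of `S`. -/
def IsPartitionWord : Finset α → List (Finset α) → Prop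
  | S, [] => S = ∅
  | S, B :: w => B.Nonempty ∧ B ⊆ S ∧ IsPartitionWord (S \ B) w

variable (K) in
/-- The span of the ordered partitions of `S` into `k` blocks. -/
noncomputable def partitionSpan (S : Finset α) (k : ℕ) : Submodule K (List (Finset α) →₀ K) :=
  Submodule.span K ((fun w => Finsupp.single w 1) '' {w | IsPartitionWord S w ∧ w.length = k})

lemma single_mem_partitionSpan {S : Finset α} {w : List (Finset α)} (hw : IsPartitionWord S w) :
    Finsupp.single w 1 ∈ partitionSpan K S w.length :=
  Submodule.subset_span ⟨w, ⟨hw, rfl⟩, rfl⟩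

lemma partitionSpan_zero_le (S : Finset α) :
    partitionSpan K S 0 ≤ K ∙ Finsupp.single ([] : List (Finset α)) (1 : K) := by
  refine Submodule.span_mono ?_
  rintro _ ⟨w, ⟨-, hw⟩, rfl⟩
  rw [List.length_eq_zero_iff.1 hw]
  rfl

lemma partitionSpan_zero_of_nonempty {S : Finset α} (hS : S.Nonempty) :
    partitionSpan K S 0 = ⊥ := by
  refine Submodule.span_eq_bot.2 ?_
  rintro _ ⟨w, ⟨hw, hl⟩, rfl⟩
  rw [List.length_eq_zero_iff.1 hl] at hw
  exact absurd hw hS.ne_empty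

lemma prepend_mem_partitionSpan {S B : Finset α} {k : ℕ} (hB : B ⊆ S)
    {x : List (Finset α) →₀ K} (hx : x ∈ partitionSpan K (S \ B) k) :
    prepend K B x ∈ partitionSpan K S (k + 1) := by
  rcases B.eq_empty_or_nonempty with rfl | hne
  · simp
  suffices h : partitionSpan K (S \ B) k ≤ (partitionSpan K S (k + 1)).comap (prepend K B) from
    h hx
  refine Submodule.span_le.2 ?_
  rintro _ ⟨w, ⟨hw, rfl⟩, rfl⟩
  simp only [SetLike.mem_coe, Submodule.mem_comap, prepend_single hne]
  exact single_mem_partitionSpan (w := B :: w) ⟨hne, hB, hw⟩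

lemma partitionSpan_succ_le {S : Finset α} {k : ℕ} {Q : Submodule K (List (Finset α) →₀ K)}
    (h : ∀ B ⊆ S, B.Nonempty → ∀ x ∈ partitionSpan K (S \ B) k, prepend K B x ∈ Q) :
    partitionSpan K S (k + 1) ≤ Q := by
  refine Submodule.span_le.2 ?_
  rintro _ ⟨w, ⟨hw, hl⟩, rfl⟩
  cases w with
  | nil => simp at hl
  | cons B w =>
    obtain ⟨hB, hBS, hw⟩ := hw
    obtain rfl : w.length = k := by simpa using hl
    simpa [prepend_single hB] using h B hBS hB _ (single_mem_partitionSpan hw)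

lemma exists_of_mem_partitionSpan_zero {S : Finset α} {x : List (Finset α) →₀ K}
    (hx : x ∈ partitionSpan K S 0) : ∃ c : K, x = Finsupp.single [] c := by
  obtain ⟨c, rfl⟩ := Submodule.mem_span_singleton.1 (partitionSpan_zero_le S hx)
  exact ⟨c, by simp⟩

lemma prepend_prepend_mem_partitionSpan {S A B : Finset α} {k : ℕ} (hA : A ⊆ B) (hB : B ⊆ S)
    {x : List (Finset α) →₀ K} (hx : x ∈ partitionSpan K (S \ B) k) :
    prepend K A (prepend K (B \ A) x) ∈ partitionSpan K S (k + 2) := by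
  refine prepend_mem_partitionSpan (hA.trans hB)
    (prepend_mem_partitionSpan (sdiff_subset_sdiff hB le_rfl) ?_)
  rwa [sdiff_sdiff_left, sup_eq_union, union_sdiff_of_subset hA]

lemma differential_mem_partitionSpan {S : Finset α} {k : ℕ} {x : List (Finset α) →₀ K}
    (hx : x ∈ partitionSpan K S k) : differential K x ∈ partitionSpan K S (k + 1) := by
  induction k generalizing S x with
  | zero =>
    obtain ⟨c, rfl⟩ := exists_of_mem_partitionSpan_zero hx
    simp
  | succ k ih =>
    refine partitionSpan_succ_le (Q := (partitionSpan K S (k + 2)).comap (differential K))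
      (fun B hB _ y hy => ?_) hx
    rw [Submodule.mem_comap, differential_prepend]
    refine Submodule.sub_mem _ (Submodule.sum_mem _ fun A hA => ?_) ?_
    · exact prepend_prepend_mem_partitionSpan (mem_powerset.1 hA) hB hy
    · exact prepend_mem_partitionSpan hB (ih hy)

lemma differential_differential {S : Finset α} {k : ℕ} {x : List (Finset α) →₀ K}
    (hx : x ∈ partitionSpan K S k) : differential K (differential K x) = 0 := by
  induction k generalizing S x with
  | zero =>
    obtain ⟨c, rfl⟩ := exists_of_mem_partitionSpan_zero hx
    simp
  | succ k ih =>
    suffices h : partitionSpan K S (k + 1) ≤ LinearMap.ker (differential K ∘ₗ differential K) from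
      LinearMap.mem_ker.1 (h hx)
    refine partitionSpan_succ_le fun B hB _ y hy => ?_
    have := sum_powerset_powerset_sdiff B
      fun A₁ A₂ A₃ => prepend K A₁ (prepend K A₂ (prepend K A₃ y))
    simp only [LinearMap.mem_ker, LinearMap.comp_apply, differential_prepend, map_sub, map_sum,
      ih hy, sum_sub_distrib, this, map_zero]
    abel

lemma absorb_mem_partitionSpan {S : Finset α} {k : ℕ} {m : α} (hm : m ∈ S)
    {x : List (Finset α) →₀ K} (hx : x ∈ partitionSpan K (S \ {m}) k) :
    absorb K m x ∈ partitionSpan K S k := by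
  cases k with
  | zero =>
    obtain ⟨c, rfl⟩ := exists_of_mem_partitionSpan_zero hx
    simp
  | succ k =>
    refine partitionSpan_succ_le (Q := (partitionSpan K S (k + 1)).comap (absorb K m))
      (fun C hC hne y hy => ?_) hx
    rw [Submodule.mem_comap, absorb_prepend m hne]
    refine prepend_mem_partitionSpan (insert_subset hm (hC.trans sdiff_subset)) ?_
    rwa [sdiff_sdiff_left, sup_eq_union, singleton_union] at hy

lemma homotopy_mem_partitionSpan {S : Finset α} {k : ℕ} {m : α} (hm : m ∈ S)
    {x : List (Finset α) →₀ K} (hx : x ∈ partitionSpan K S (k + 1)) :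
    homotopy K m x ∈ partitionSpan K S k := by
  induction k generalizing S x with
  | zero =>
    refine partitionSpan_succ_le (Q := (partitionSpan K S 0).comap (homotopy K m))
      (fun B hB hne y hy => ?_) hx
    obtain ⟨c, rfl⟩ := exists_of_mem_partitionSpan_zero hy
    rw [Submodule.mem_comap]
    by_cases hmB : m ∈ B
    · rw [← insert_erase hmB]
      rcases (B.erase m).eq_empty_or_nonempty with h | h
      · rw [h, insert_empty_eq, homotopy_prepend_singleton]
        simp
      · simp [homotopy_prepend_insert h (notMem_erase m B)]
    · simp [homotopy_prepend_of_notMem hmB]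
  | succ k ih =>
    refine partitionSpan_succ_le (Q := (partitionSpan K S (k + 1)).comap (homotopy K m))
      (fun B hB hne y hy => ?_) hx
    rw [Submodule.mem_comap]
    by_cases hmB : m ∈ B
    · rw [← insert_erase hmB] at hy ⊢
      rcases (B.erase m).eq_empty_or_nonempty with h | h
      · rw [h, insert_empty_eq] at hy ⊢
        rw [homotopy_prepend_singleton]
        exact absorb_mem_partitionSpan hm hy
      · simp [homotopy_prepend_insert h (notMem_erase m B)]
    · rw [homotopy_prepend_of_notMem hmB]
      exact neg_mem (prepend_mem_partitionSpan hB (ih (mem_sdiff.2 ⟨hm, hmB⟩) hy))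

lemma appendSingleton_prepend (m : α) (B : Finset α) (x : List (Finset α) →₀ K) :
    appendSingleton K m (prepend K B x) = prepend K B (appendSingleton K m x) := by
  rcases B.eq_empty_or_nonempty with rfl | hB
  · simp
  induction x using Finsupp.induction_linear with
  | zero => simp
  | add x y hx hy => simp only [map_add, hx, hy]
  | single w c => simp [prepend_single hB, appendSingleton]

lemma appendSingleton_single_nil (m : α) (c : K) :
    appendSingleton K m (Finsupp.single [] c) = prepend K {m} (Finsupp.single [] c) := by
  simp [prepend_single, appendSingleton]

lemma differential_appendSingleton (m : α) {S : Finset α} {k : ℕ}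
    {x : List (Finset α) →₀ K} (hx : x ∈ partitionSpan K S k) :
    differential K (appendSingleton K m x) = appendSingleton K m (differential K x) := by
  induction k generalizing S x with
  | zero =>
    obtain ⟨c, rfl⟩ := exists_of_mem_partitionSpan_zero hx
    have : ({m} : Finset α) = insert m ∅ := rfl
    rw [appendSingleton_single_nil, differential_prepend, this,
      sum_powerset_insert (notMem_empty m)]
    simp
  | succ k ih =>
    refine partitionSpan_succ_le (Q := LinearMap.eqLocus
      (differential K ∘ₗ appendSingleton K m) (appendSingleton K m ∘ₗ differential K))
      (fun B hB _ y hy => ?_) hx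
    simp only [LinearMap.mem_eqLocus, LinearMap.comp_apply, appendSingleton_prepend,
      differential_prepend, map_sub, map_sum, ih hy]

lemma appendSingleton_mem_partitionSpan {S : Finset α} {m : α} (hm : m ∈ S) {k : ℕ}
    {x : List (Finset α) →₀ K} (hx : x ∈ partitionSpan K (S \ {m}) k) :
    appendSingleton K m x ∈ partitionSpan K S (k + 1) := by
  induction k generalizing S x with
  | zero =>
    obtain ⟨c, rfl⟩ := exists_of_mem_partitionSpan_zero hx
    rw [appendSingleton_single_nil]
    exact prepend_mem_partitionSpan (singleton_subset_iff.2 hm) hx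
  | succ k ih =>
    refine partitionSpan_succ_le (Q := (partitionSpan K S (k + 2)).comap (appendSingleton K m))
      (fun B hB _ y hy => ?_) hx
    obtain ⟨hBS, hmB⟩ := subset_sdiff.1 hB
    rw [disjoint_singleton_right] at hmB
    rw [Submodule.mem_comap, appendSingleton_prepend]
    rw [sdiff_right_comm] at hy
    exact prepend_mem_partitionSpan hBS (ih (mem_sdiff.2 ⟨hm, hmB⟩) hy)

lemma shift_appendSingleton {m : α} {S : Finset α} (hm : m ∉ S) {k : ℕ}
    {x : List (Finset α) →₀ K} (hx : x ∈ partitionSpan K S k) :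
    shift K m (appendSingleton K m x) = appendSingleton K m x := by
  induction k generalizing S x with
  | zero =>
    obtain ⟨c, rfl⟩ := exists_of_mem_partitionSpan_zero hx
    simp [appendSingleton_single_nil, shift_prepend_singleton]
  | succ k ih =>
    refine partitionSpan_succ_le (Q := LinearMap.eqLocus
      (shift K m ∘ₗ appendSingleton K m) (appendSingleton K m))
      (fun B hB _ y hy => ?_) hx
    simp only [LinearMap.mem_eqLocus, LinearMap.comp_apply, appendSingleton_prepend,
      shift_prepend_of_notMem fun h => hm (hB h), ih (fun h => hm (sdiff_subset h)) hy]

lemma shift_pow_prepend_of_notMem {m : α} {B : Finset α} (hm : m ∉ B) (j : ℕ)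
    (x : List (Finset α) →₀ K) :
    (shift K m ^ j) (prepend K B x) = prepend K B ((shift K m ^ j) x) := by
  induction j with
  | zero => simp
  | succ j ih => simp only [pow_succ', Module.End.mul_apply, ih, shift_prepend_of_notMem hm]

lemma shift_pow_mem_map_appendSingleton {S : Finset α} {m : α} (hm : m ∈ S) {k : ℕ}
    {x : List (Finset α) →₀ K} (hx : x ∈ partitionSpan K S (k + 1)) :
    (shift K m ^ (k + 1)) x ∈
      (partitionSpan K (S \ {m}) k).map (appendSingleton K m) := by
  induction k using Nat.strong_induction_on generalizing S x with
  | _ k ih =>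
  have prepend_mem : ∀ B ⊆ S, m ∉ B → ∀ y ∈ partitionSpan K (S \ B) k,
      (shift K m ^ k) (prepend K B y) ∈
        (partitionSpan K (S \ {m}) k).map (appendSingleton K m) := by
    intro B hB hmB y hy
    have hmSB : m ∈ S \ B := mem_sdiff.2 ⟨hm, hmB⟩
    cases k with
    | zero =>
      rw [partitionSpan_zero_of_nonempty ⟨m, hmSB⟩, Submodule.mem_bot] at hy
      simp [hy]
    | succ k =>
      obtain ⟨z, hz, hzy⟩ := ih k k.lt_succ_self hmSB hy
      rw [shift_pow_prepend_of_notMem hmB, ← hzy, ← appendSingleton_prepend]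
      rw [SetLike.mem_coe, sdiff_right_comm] at hz
      refine Submodule.mem_map_of_mem (prepend_mem_partitionSpan ?_ hz)
      exact subset_sdiff.2 ⟨hB, disjoint_singleton_right.2 hmB⟩
  refine partitionSpan_succ_le (Q := ((partitionSpan K (S \ {m}) k).map
    (appendSingleton K m)).comap (shift K m ^ (k + 1))) (fun B hB hne y hy => ?_) hx
  rw [Submodule.mem_comap]
  by_cases hmB : m ∈ B
  · rw [pow_succ, Module.End.mul_apply]
    rw [← insert_erase hmB] at hy ⊢
    have hmC := notMem_erase m B
    have hCS : B.erase m ⊆ S := (erase_subset m B).trans hB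
    rcases (B.erase m).eq_empty_or_nonempty with h | h
    · rw [h, insert_empty_eq] at hy ⊢
      cases k with
      | zero =>
        obtain ⟨c, rfl⟩ := exists_of_mem_partitionSpan_zero hy
        refine ⟨_, hy, ?_⟩
        simp [shift_prepend_singleton, appendSingleton_single_nil]
      | succ k =>
        refine partitionSpan_succ_le (Q := ((partitionSpan K (S \ {m}) (k + 1)).map
          (appendSingleton K m)).comap ((shift K m ^ (k + 1) : Module.End K _) ∘ₗ
            shift K m ∘ₗ prepend K {m}))
          (fun C hC hCne z hz => ?_) hy
        obtain ⟨hCS, hmC⟩ := subset_sdiff.1 hC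
        rw [disjoint_singleton_right] at hmC
        simp only [Submodule.mem_comap, LinearMap.comp_apply,
          shift_prepend_singleton_prepend hCne hmC, map_neg, map_sum]
        refine neg_mem (sum_mem fun A hA => ?_)
        rw [mem_powerset] at hA
        refine prepend_mem A (hA.trans hCS) (fun h => hmC (hA h)) _ ?_
        refine prepend_mem_partitionSpan (insert_subset (mem_sdiff.2 ⟨hm, fun h => hmC (hA h)⟩)
          (sdiff_subset_sdiff hCS le_rfl)) ?_
        convert hz using 2
        rw [sdiff_sdiff_left, sdiff_sdiff_left, sup_eq_union, sup_eq_union, union_insert,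
          union_sdiff_of_subset hA, singleton_union]
    · rw [shift_prepend_insert h hmC]
      refine prepend_mem _ hCS hmC _ (absorb_mem_partitionSpan (mem_sdiff.2 ⟨hm, hmC⟩) ?_)
      rwa [sdiff_sdiff_left, sup_eq_union, union_singleton]
  · obtain ⟨z, hz, hzy⟩ := prepend_mem B hB hmB y hy
    rw [pow_succ', Module.End.mul_apply, ← hzy,
      shift_appendSingleton (S := S \ {m}) (by simp) hz]
    exact Submodule.mem_map_of_mem hz

lemma exists_shift_pow_eq_sub_differential {S : Finset α} {m : α} (hm : m ∈ S) {k : ℕ}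
    {x : List (Finset α) →₀ K} (hx : x ∈ partitionSpan K S (k + 1))
    (hdx : differential K x = 0) (j : ℕ) :
    ∃ y ∈ partitionSpan K S k, (shift K m ^ j) x = x - differential K y := by
  induction j with
  | zero => exact ⟨0, zero_mem _, by simp⟩
  | succ j ih =>
    obtain ⟨y, hy, hyx⟩ := ih
    refine ⟨y + homotopy K m (x - differential K y), add_mem hy
      (homotopy_mem_partitionSpan hm (sub_mem hx (differential_mem_partitionSpan hy))), ?_⟩
    rw [pow_succ', Module.End.mul_apply, hyx]
    simp only [shift, LinearMap.sub_apply, LinearMap.add_apply, LinearMap.comp_apply,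
      LinearMap.id_apply, map_sub, map_add, hdx, differential_differential hy, map_zero]
    abel

/-- Below the top degree, cocycles of ordered partitions of `S` are coboundaries. -/
theorem exists_differential_eq {S : Finset α} {k : ℕ} (hk : k + 1 < #S)
    {x : List (Finset α) →₀ K} (hx : x ∈ partitionSpan K S (k + 1))
    (hdx : differential K x = 0) : ∃ y ∈ partitionSpan K S k, differential K y = x := by
  induction k generalizing S x with
  | zero =>
    obtain ⟨m, hm⟩ : S.Nonempty := card_pos.1 (by omega)
    have hS : (S \ {m}).Nonempty := card_pos.1 (by
      rw [card_sdiff_of_subset (singleton_subset_iff.2 hm), card_singleton]; omega)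
    obtain ⟨y, hy, hyx⟩ := exists_shift_pow_eq_sub_differential hm hx hdx 1
    have := shift_pow_mem_map_appendSingleton hm hx
    rw [partitionSpan_zero_of_nonempty hS, Submodule.map_bot, Submodule.mem_bot, zero_add, hyx]
      at this
    exact ⟨y, hy, (sub_eq_zero.1 this).symm⟩
  | succ k ih =>
    obtain ⟨m, hm⟩ : S.Nonempty := card_pos.1 (by omega)
    have hS : k + 1 < #(S \ {m}) := by
      rw [card_sdiff_of_subset (singleton_subset_iff.2 hm), card_singleton]; omega
    obtain ⟨y, hy, hyx⟩ := exists_shift_pow_eq_sub_differential hm hx hdx (k + 2)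
    obtain ⟨u, hu, hux⟩ := shift_pow_mem_map_appendSingleton hm hx
    have hxy : x = differential K y + appendSingleton K m u := by
      rw [hux, hyx]; abel
    have hdu : differential K u = 0 := by
      refine Finsupp.mapDomain_injective (List.append_left_injective [{m}]) ?_
      change appendSingleton K m (differential K u) = appendSingleton K m 0
      rw [← differential_appendSingleton m hu, map_zero, hux, hyx, map_sub, hdx,
        differential_differential hy, sub_zero]
    obtain ⟨v, hv, rfl⟩ := ih hS hu hdu
    refine ⟨y + appendSingleton K m v, add_mem hy ?_, ?_⟩
    · exact appendSingleton_mem_partitionSpan hm hv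
    · rw [map_add, differential_appendSingleton m hv, hxy]

end Words

section Comparison

variable {K : Type*} [Field K] {n : ℕ}

lemma splitBlocks_castSucc {k : ℕ} (B : Fin k → Finset (Fin n)) (i : Fin k)
    (A A' : Finset (Fin n)) : splitBlocks B i A A' i.castSucc = A := by
  simp [splitBlocks]

lemma splitBlocks_succ {k : ℕ} (B : Fin k → Finset (Fin n)) (i : Fin k)
    (A A' : Finset (Fin n)) : splitBlocks B i A A' i.succ = A' := by
  simp [splitBlocks, Function.update_of_ne (Fin.castSucc_lt_succ (i := i)).ne']

lemma ofFn_splitBlocks_zero {k : ℕ} (B : Fin (k + 1) → Finset (Fin n))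
    (A A' : Finset (Fin n)) :
    List.ofFn (splitBlocks B 0 A A') = A :: A' :: List.ofFn (Fin.tail B) := by
  have tail_eq (j : Fin k) : splitBlocks B 0 A A' j.succ.succ = Fin.tail B j := by
    have : (j.succ.succ : Fin (k + 2)) = (Fin.succ 0).succAbove j.succ := by simp
    rw [splitBlocks, Function.update_of_ne (by simp [Fin.ext_iff]), this,
      Fin.insertNth_apply_succAbove]
    rfl
  rw [List.ofFn_succ, List.ofFn_succ]
  simp only [tail_eq]
  exact congrArg₂ _ (splitBlocks_castSucc B 0 A A')
    (congrArg₂ _ (splitBlocks_succ B 0 A A') rfl)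

lemma ofFn_splitBlocks_succ {k : ℕ} (B : Fin (k + 1) → Finset (Fin n)) (i : Fin k)
    (A A' : Finset (Fin n)) :
    List.ofFn (splitBlocks B i.succ A A') =
      B 0 :: List.ofFn (splitBlocks (Fin.tail B) i A A') := by
  have head_eq : splitBlocks B i.succ A A' 0 = B 0 := by
    have : (0 : Fin (k + 2)) = i.succ.succ.succAbove 0 := by simp
    rw [splitBlocks, Function.update_of_ne (by simp [Fin.ext_iff]), this,
      Fin.insertNth_apply_succAbove]
  have tail_eq (j : Fin (k + 1)) :
      splitBlocks B i.succ A A' j.succ = splitBlocks (Fin.tail B) i A A' j := by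
    rcases eq_or_ne j i.castSucc with rfl | hj
    · rw [splitBlocks_castSucc, Fin.succ_castSucc, splitBlocks_castSucc]
    · rw [splitBlocks, splitBlocks, Function.update_of_ne hj, Function.update_of_ne
        (by rwa [← Fin.succ_castSucc, Ne, Fin.succ_inj])]
      induction j using Fin.succAboveCases i.succ with
      | x => rw [Fin.insertNth_apply_same, Fin.insertNth_apply_same]
      | p j =>
        rw [← Fin.succ_succAbove_succ, Fin.insertNth_apply_succAbove,
          Fin.insertNth_apply_succAbove]
        rfl
  rw [List.ofFn_succ, head_eq]
  simp only [tail_eq]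

lemma isPartitionWord_ofFn_iff {k : ℕ} {S : Finset (Fin n)} {B : Fin k → Finset (Fin n)} :
    IsPartitionWord S (List.ofFn B) ↔
      (∀ i, (B i).Nonempty) ∧ (∀ i, B i ⊆ S) ∧ ∀ x ∈ S, ∃! i, x ∈ B i := by
  induction k generalizing S with
  | zero => simp [IsPartitionWord, eq_empty_iff_forall_notMem, ExistsUnique]
  | succ k ih =>
    rw [List.ofFn_succ, IsPartitionWord, ih]
    simp only [Fin.forall_fin_succ]
    constructor
    · rintro ⟨h₀, h₀S, hne, hS, hu⟩
      refine ⟨⟨h₀, hne⟩, ⟨h₀S, fun i => (hS i).trans sdiff_subset⟩, fun x hx => ?_⟩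
      by_cases hx₀ : x ∈ B 0
      · refine ⟨0, hx₀, fun j hj => ?_⟩
        induction j using Fin.cases with
        | zero => rfl
        | succ j => exact absurd hx₀ (mem_sdiff.1 (hS j hj)).2
      · obtain ⟨i, hi, hi'⟩ := hu x (mem_sdiff.2 ⟨hx, hx₀⟩)
        refine ⟨i.succ, hi, fun j hj => ?_⟩
        induction j using Fin.cases with
        | zero => exact absurd hj hx₀
        | succ j => rw [hi' j hj]
    · rintro ⟨⟨h₀, hne⟩, ⟨h₀S, hS⟩, hu⟩
      refine ⟨h₀, h₀S, hne, fun i x hx => ?_, fun x hx => ?_⟩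
      · refine mem_sdiff.2 ⟨hS i hx, fun hx₀ => ?_⟩
        exact Fin.succ_ne_zero i ((hu x (hS i hx)).unique hx hx₀)
      · obtain ⟨hx, hx₀⟩ := mem_sdiff.1 hx
        obtain ⟨i, hi, hi'⟩ := hu x hx
        induction i using Fin.cases with
        | zero => exact absurd hi hx₀
        | succ i => exact ⟨i, hi, fun j hj => Fin.succ_injective _ (hi' _ hj)⟩

lemma isOrderedPartition_iff {k : ℕ} {B : Fin k → Finset (Fin n)} :
    IsOrderedPartition n k B ↔ IsPartitionWord univ (List.ofFn B) := by
  simp [IsOrderedPartition, isPartitionWord_ofFn_iff]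

lemma isPartitionWord_splitBlocks {k : ℕ} {S : Finset (Fin n)} {B : Fin k → Finset (Fin n)}
    (hB : IsPartitionWord S (List.ofFn B)) {i : Fin k} {A : Finset (Fin n)} (hA : A ⊆ B i)
    (hne : A.Nonempty) (hne' : (B i \ A).Nonempty) :
    IsPartitionWord S (List.ofFn (splitBlocks B i A (B i \ A))) := by
  induction k generalizing S with
  | zero => exact i.elim0
  | succ k ih =>
    rw [List.ofFn_succ] at hB
    obtain ⟨h₀, h₀S, hB⟩ := hB
    induction i using Fin.cases with
    | zero =>
      rw [ofFn_splitBlocks_zero]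
      refine ⟨hne, hA.trans h₀S, hne', sdiff_subset_sdiff h₀S le_rfl, ?_⟩
      rwa [sdiff_sdiff_left, sup_eq_union, union_sdiff_of_subset hA]
    | succ i =>
      rw [ofFn_splitBlocks_succ]
      exact ⟨h₀, h₀S, ih (B := Fin.tail B) hB hA hne'⟩

lemma isOrderedPartition_splitBlocks_iff {k : ℕ} {B : Fin k → Finset (Fin n)}
    (hB : IsOrderedPartition n k B) {i : Fin k} {A : Finset (Fin n)} (hA : A ⊆ B i) :
    IsOrderedPartition n (k + 1) (splitBlocks B i A (B i \ A)) ↔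
      A.Nonempty ∧ (B i \ A).Nonempty := by
  refine ⟨fun h => ⟨?_, ?_⟩, fun h => ?_⟩
  · simpa [splitBlocks_castSucc] using h.1 i.castSucc
  · simpa [splitBlocks_succ] using h.1 i.succ
  · exact isOrderedPartition_iff.2
      (isPartitionWord_splitBlocks (isOrderedPartition_iff.1 hB) hA h.1 h.2)

lemma differential_single_ofFn {k : ℕ} {B : Fin k → Finset (Fin n)}
    (hB : ∀ i, (B i).Nonempty) :
    differential K (Finsupp.single (List.ofFn B) 1) =
      ∑ i : Fin k, ∑ A ∈ (B i).powerset, if A.Nonempty ∧ (B i \ A).Nonempty then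
        (-1 : K) ^ (i : ℕ) • Finsupp.single (List.ofFn (splitBlocks B i A (B i \ A))) 1
      else 0 := by
  induction k with
  | zero => simp
  | succ k ih =>
    rw [List.ofFn_succ, ← prepend_single (hB 0), differential_prepend, Fin.sum_univ_succ,
      sub_eq_add_neg]
    congr 1
    · refine sum_congr rfl fun A _ => ?_
      rcases A.eq_empty_or_nonempty with rfl | hA
      · simp
      rcases (B 0 \ A).eq_empty_or_nonempty with h | h
      · simp [h]
      · rw [if_pos ⟨hA, h⟩, prepend_single h, prepend_single hA, ofFn_splitBlocks_zero]
        simp [Fin.tail_def]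
    · rw [ih fun i => hB i.succ]
      simp only [map_sum, ← sum_neg_distrib]
      refine sum_congr rfl fun i _ => sum_congr rfl fun A _ => ?_
      split_ifs
      · rw [map_smul, prepend_single (hB 0), ofFn_splitBlocks_succ, Fin.val_succ, pow_succ,
          mul_neg_one, neg_smul]
        rfl
      · simp

variable (K n) in
/-- The embedding of the free space on ordered partitions into the span of all words. -/
noncomputable def toWords (k : ℕ) : OPC K n k →ₗ[K] (List (Finset (Fin n)) →₀ K) :=
  Finsupp.lmapDomain K K fun B => List.ofFn B.1

lemma toWords_single {k : ℕ} {B : Fin k → Finset (Fin n)} (hB : IsOrderedPartition n k B) (c : K) :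
    toWords K n k (Finsupp.single (⟨B, hB⟩ : OrderedPartition n k) c) =
      Finsupp.single (List.ofFn B) c :=
  Finsupp.mapDomain_single

lemma toWords_injective (k : ℕ) : Function.Injective (toWords K n k) :=
  Finsupp.mapDomain_injective (List.ofFn_injective.comp Subtype.val_injective)

lemma toWords_dOP {k : ℕ} (x : OPC K n k) :
    toWords K n (k + 1) (dOP K n k x) = differential K (toWords K n k x) := by
  suffices h : toWords K n (k + 1) ∘ₗ dOP K n k = differential K ∘ₗ toWords K n k from
    LinearMap.congr_fun h x
  refine Finsupp.lhom_ext' fun B => LinearMap.ext_ring ?_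
  have hB : toWords K n k (Finsupp.single B 1) = Finsupp.single (List.ofFn B.1) 1 :=
    toWords_single B.2 1
  simp only [LinearMap.comp_apply, Finsupp.lsingle_apply]
  rw [hB, differential_single_ofFn B.2.1]
  simp only [dOP, Finsupp.lsum_single, LinearMap.toSpanSingleton_apply, one_smul, map_sum]
  refine sum_congr rfl fun i _ => sum_congr rfl fun A hA => ?_
  have := isOrderedPartition_splitBlocks_iff B.2 (mem_powerset.1 hA)
  by_cases h : IsOrderedPartition n (k + 1) (splitBlocks B.1 i A (B.1 i \ A))
  · rw [if_pos (this.1 h)]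
    exact (congrArg _ (dif_pos h)).trans
      ((map_smul (toWords K n (k + 1)) _ _).trans (congrArg _ (toWords_single h 1)))
  · rw [if_neg (mt this.2 h)]
    exact (congrArg _ (dif_neg h)).trans (map_zero _)

lemma range_toWords (k : ℕ) :
    LinearMap.range (toWords K n k) = partitionSpan K univ k := by
  refine le_antisymm ?_ (Submodule.span_le.2 ?_)
  · rintro _ ⟨x, rfl⟩
    induction x using Finsupp.induction_linear with
    | zero => simp
    | add x y hx hy => rw [map_add]; exact add_mem hx hy
    | single B c =>
      have := Submodule.smul_mem _ c
        (single_mem_partitionSpan (K := K) (isOrderedPartition_iff.1 B.2))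
      simpa [toWords] using this
  · rintro _ ⟨w, ⟨hw, rfl⟩, rfl⟩
    rw [← List.ofFn_get w, ← isOrderedPartition_iff] at hw
    refine ⟨Finsupp.single ⟨_, hw⟩ 1, ?_⟩
    exact (toWords_single hw 1).trans (by rw [List.ofFn_get])

end Comparison

end OrderedPartitionComplex

/-- for `1 ≤ k ≤ n − 1` (here `k` is written as `k+1` with `k : ℕ` to avoid
natural subtraction in the types), the cohomology of the ordered-partition complex
vanishes: `ker (d : C^{k+1} → C^{k+2}) = im (d : C^k → C^{k+1})`. -/
theorem statement0 (K : Type*) [Field K] [CharZero K] (n : ℕ) (hn : 1 ≤ n)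
    (k : ℕ) (hk1 : 1 ≤ k + 1) (hk2 : k + 1 ≤ n - 1) :
    LinearMap.ker (dOP K n (k + 1)) = LinearMap.range (dOP K n k) := by
  open OrderedPartitionComplex in
  ext x
  rw [LinearMap.mem_ker, LinearMap.mem_range]
  have mem_span (j : ℕ) (z : OPC K n j) :
      toWords K n j z ∈ partitionSpan K Finset.univ j :=
    range_toWords (K := K) (n := n) j ▸ LinearMap.mem_range_self _ z
  constructor
  · intro hx
    obtain ⟨y, hy, hyx⟩ := exists_differential_eq (by rw [Finset.card_fin]; omega)
      (mem_span (k + 1) x) (by rw [← toWords_dOP, hx, map_zero])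
    rw [← range_toWords] at hy
    obtain ⟨z, rfl⟩ := hy
    exact ⟨z, toWords_injective _ (by rw [toWords_dOP, hyx])⟩
  · rintro ⟨y, rfl⟩
    refine toWords_injective _ ?_
    rw [toWords_dOP, toWords_dOP, differential_differential (mem_span k y), map_zero]
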